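/- Under the featured correlated Gaussian Wigner model G(n,d,ρ,r), suppose d = ω(log n) and n·log(1/(1−ρ²)) + 2d·log(1/(1−r²)) ≥ (4+ε)·log n for some constant ε > 0. Then there exists an estimator π̂ = π̂(G1,G2) (one may take the maximum likelihood estimator π̂ ∈ argmax_{π∈S_n} S_π(G1,G2)) such that for every fixed constant 0 < δ < 1 and every π* ∈ S_n, P[overlap(π̂, π*) ≥ δ] = 1 − o(1) as n → ∞. -/

import Mathlib

open MeasureTheory ProbabilityTheory Filter
open scoped ENNReal

namespace FCGW

/-- `phi x = x / (1 - x^2)`, the weight function `φ` from the paper. -/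
noncomputable def phi (x : ℝ) : ℝ := x / (1 - x ^ 2)

/-- The edge set of the complete graph on `Fin n`: non-diagonal unordered pairs. -/
abbrev Edge (n : ℕ) := {e : Sym2 (Fin n) // ¬ e.IsDiag}

lemma map_not_isDiag {n : ℕ} (π : Equiv.Perm (Fin n)) (e : Sym2 (Fin n)) :
    ¬ e.IsDiag → ¬ (Sym2.map π e).IsDiag := by
  induction e using Sym2.ind with
  | _ x y =>
    simp only [Sym2.map_pair_eq, Sym2.mk_isDiag_iff]
    exact fun he h => he (π.injective h)

/-- Action of a vertex permutation on edges: `π({u,v}) = {π(u), π(v)}`. -/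
def edgeMap {n : ℕ} (π : Equiv.Perm (Fin n)) (e : Edge n) : Edge n :=
  ⟨Sym2.map π e.1, map_not_isDiag π e.1 e.2⟩

/-- The observation space: edge weights of `G1`, edge weights of `G2`,
features of `G1`, features of `G2`. -/
abbrev Obs (n d : ℕ) :=
  (Edge n → ℝ) × (Edge n → ℝ) × (Fin n → Fin d → ℝ) × (Fin n → Fin d → ℝ)

/-- The law of a pair of jointly Gaussian standard normals with correlation `ρ`,
i.e. a centered Gaussian vector in `ℝ²` with covariance `[[1, ρ], [ρ, 1]]`. -/
noncomputable def gaussianPair (ρ : ℝ) : Measure (ℝ × ℝ) :=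
  Measure.map (fun z : ℝ × ℝ => (z.1, ρ * z.1 + Real.sqrt (1 - ρ ^ 2) * z.2))
    ((gaussianReal 0 1).prod (gaussianReal 0 1))

/-- The law `N(0, Σ_d)` with `Σ_d = [[I_d, r I_d], [r I_d, I_d]]` of a correlated
feature pair `(x, y) ∈ ℝ^d × ℝ^d`. -/
noncomputable def featurePair (d : ℕ) (r : ℝ) : Measure ((Fin d → ℝ) × (Fin d → ℝ)) :=
  Measure.map (fun z : (Fin d → ℝ) × (Fin d → ℝ) =>
      (z.1, fun i => r * z.1 i + Real.sqrt (1 - r ^ 2) * z.2 i))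
    ((Measure.pi fun _ : Fin d => gaussianReal 0 1).prod
      (Measure.pi fun _ : Fin d => gaussianReal 0 1))

/-- The underlying randomness of the featured correlated Gaussian Wigner model:
independent correlated Gaussian pairs for each edge of `G1` and independent
correlated feature pairs for each vertex of `G1`. -/
noncomputable def sample (n d : ℕ) (ρ r : ℝ) :
    Measure ((Edge n → ℝ × ℝ) × (Fin n → (Fin d → ℝ) × (Fin d → ℝ))) :=
  (Measure.pi fun _ : Edge n => gaussianPair ρ).prod
    (Measure.pi fun _ : Fin n => featurePair d r)

/-- The observations `(β(G1), β(G2), x, y)` produced from the underlying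
randomness when the latent vertex correspondence is `πs`: the pair at edge `e`
gives the weight of `e` in `G1` and of `πs(e)` in `G2`, and the feature pair at a
vertex `v` gives the feature of `v` in `G1` and of `πs(v)` in `G2`. -/
noncomputable def obsOf {n d : ℕ} (πs : Equiv.Perm (Fin n))
    (ω : (Edge n → ℝ × ℝ) × (Fin n → (Fin d → ℝ) × (Fin d → ℝ))) : Obs n d :=
  (fun e => (ω.1 e).1,
   fun f => (ω.1 (edgeMap πs⁻¹ f)).2,
   fun v => (ω.2 v).1,
   fun v => (ω.2 (πs⁻¹ v)).2)

/-- The law of the observed pair of featured graphs `(G1, G2)` under the featured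
correlated Gaussian Wigner model `G(n, d, ρ, r)` with latent correspondence `πs`. -/
noncomputable def obsLaw (n d : ℕ) (ρ r : ℝ) (πs : Equiv.Perm (Fin n)) :
    Measure (Obs n d) :=
  Measure.map (obsOf πs) (sample n d ρ r)

/-- The similarity score
`S_π = φ(ρ) Σ_e β_e(G1) β_{π(e)}(G2) + φ(r) Σ_v ⟪x_v, y_{π(v)}⟫`. -/
noncomputable def score {n d : ℕ} (ρ r : ℝ) (o : Obs n d) (π : Equiv.Perm (Fin n)) : ℝ :=
  phi ρ * ∑ e : Edge n, o.1 e * o.2.1 (edgeMap π e)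
    + phi r * ∑ v : Fin n, ∑ i : Fin d, o.2.2.1 v i * o.2.2.2 (π v) i

/-- `overlap(π, π') = |{v : π v = π' v}| / n`. -/
noncomputable def overlap {n : ℕ} (π π' : Equiv.Perm (Fin n)) : ℝ :=
  ((Finset.univ.filter fun v => π v = π' v).card : ℝ) / n

/-- The Hamming distance `d(π, π') = |{v : π v ≠ π' v}|`. -/
def hamming {n : ℕ} (π π' : Equiv.Perm (Fin n)) : ℕ :=
  (Finset.univ.filter fun v => π v ≠ π' v).card

instance {n : ℕ} : MeasurableSpace (Equiv.Perm (Fin n)) := ⊤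

/-- The Bayesian joint law of `(π*, (G1, G2))` when `π*` is uniform on `S_n`. -/
noncomputable def bayesLaw (n d : ℕ) (ρ r : ℝ) :
    Measure (Equiv.Perm (Fin n) × Obs n d) :=
  (Nat.factorial n : ℝ≥0∞)⁻¹ •
    ∑ π : Equiv.Perm (Fin n), Measure.map (fun o => (π, o)) (obsLaw n d ρ r π)

/-- exponential as an extended nonnegative real -/
noncomputable def EE (x : ℝ) : ℝ≥0∞ := ENNReal.ofReal (Real.exp x)

lemma EE_add (x y : ℝ) : EE (x + y) = EE x * EE y := by
  unfold EE; rw [Real.exp_add, ENNReal.ofReal_mul (Real.exp_pos _).le]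

lemma EE_zero : EE 0 = 1 := by simp [EE]

lemma EE_mono {x y : ℝ} (h : x ≤ y) : EE x ≤ EE y :=
  ENNReal.ofReal_le_ofReal (Real.exp_le_exp.2 h)

lemma EE_sum {ι : Type*} (s : Finset ι) (f : ι → ℝ) : EE (∑ i ∈ s, f i) = ∏ i ∈ s, EE (f i) := by
  classical
  induction s using Finset.induction_on with
  | empty => simp [EE_zero]
  | insert a s ha ih => rw [Finset.sum_insert ha, Finset.prod_insert ha, EE_add, ih]

lemma EE_ne_zero (x : ℝ) : EE x ≠ 0 := by
  unfold EE; simp [Real.exp_pos]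

lemma EE_ne_top (x : ℝ) : EE x ≠ ⊤ := by unfold EE; simp

@[fun_prop]
lemma measurable_EE : Measurable EE := by unfold EE; fun_prop

lemma EE_card {ι : Type*} (s : Finset ι) (b : ℝ) : ∏ _i ∈ s, EE b = EE (b * s.card) := by
  rw [← EE_sum]; simp [mul_comm]

lemma lintegral_pi_prod {I : Type*} [Fintype I] {A : I → Type*} [∀ i, MeasurableSpace (A i)]
    (μ : ∀ i, Measure (A i)) [∀ i, IsProbabilityMeasure (μ i)]
    (s : Finset I) (f : ∀ i, A i → ℝ≥0∞) (hf : ∀ i, Measurable (f i)) :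
    ∫⁻ x, ∏ i ∈ s, f i (x i) ∂(Measure.pi μ) = ∏ i ∈ s, ∫⁻ x, f i x ∂(μ i) := by
  have h1 : iIndepFun (fun i (x : ∀ i, A i) => f i (x i)) (Measure.pi μ) :=
    iIndepFun_pi (fun i => (hf i).aemeasurable)
  have h2 := lintegral_prod_eq_prod_lintegral_of_indepFun s _ h1
    (fun i => (hf i).comp (measurable_pi_apply i))
  rw [h2]
  refine Finset.prod_congr rfl fun i _ => ?_
  exact (measurePreserving_eval μ i).lintegral_comp (hf i)

lemma gint_le (p q : ℝ) (hp : p < 1/2) :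
    ∫⁻ x, EE (p * x ^ 2 + q * x) ∂(gaussianReal 0 1) ≤
      EE (p / (1 - 2 * p) + q ^ 2 / (2 * (1 - 2 * p))) := by
  have hs : 0 < 1 - 2 * p := by linarith
  set s := 1 - 2 * p with hsd
  rw [gaussianReal_of_var_ne_zero _ one_ne_zero,
    lintegral_withDensity_eq_lintegral_mul _ (measurable_gaussianPDF 0 1) (by fun_prop)]
  set v : NNReal := ⟨1 / s, by positivity⟩ with hv
  have hv0 : v ≠ 0 := by
    intro h
    have h1 : (v : ℝ) = 0 := by rw [h]; rfl
    have h2 : (v : ℝ) = 1 / s := rfl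
    have h3 : 0 < 1 / s := by positivity
    rw [← h2, h1] at h3
    exact lt_irrefl _ h3
  have key : ∀ x, (gaussianPDF 0 1 * fun x => EE (p * x ^ 2 + q * x)) x
      = ENNReal.ofReal (Real.sqrt (1 / s) * Real.exp (q ^ 2 / (2 * s))) * gaussianPDF (q / s) v x := by
    intro x
    simp only [Pi.mul_apply, gaussianPDF, EE]
    rw [← ENNReal.ofReal_mul (gaussianPDFReal_nonneg _ _ _), ← ENNReal.ofReal_mul (by positivity)]
    congr 1
    simp only [gaussianPDFReal_def]
    have e1 : (v : ℝ) = 1 / s := rfl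
    rw [e1]
    have e2 : Real.sqrt (2 * Real.pi * (1 / s)) = Real.sqrt (2 * Real.pi) * Real.sqrt (1 / s) :=
      Real.sqrt_mul (by positivity) _
    rw [e2]
    have h3 : Real.sqrt (1 / s) ≠ 0 := by positivity
    have h4 : Real.sqrt (2 * Real.pi) ≠ 0 := by positivity
    have e3 : Real.exp (-(x - 0) ^ 2 / (2 * ((1 : NNReal) : ℝ))) * Real.exp (p * x ^ 2 + q * x)
        = Real.exp (q ^ 2 / (2 * s)) * Real.exp (-(x - q / s) ^ 2 / (2 * (1 / s))) := by
      rw [← Real.exp_add, ← Real.exp_add]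
      congr 1
      have : p = (1 - s) / 2 := by rw [hsd]; ring
      rw [this]
      push_cast
      field_simp
      ring
    rw [mul_assoc, e3]
    simp only [NNReal.coe_one, mul_one]
    field_simp
  simp_rw [key]
  rw [lintegral_const_mul _ (measurable_gaussianPDF _ _), lintegral_gaussianPDF_eq_one _ hv0, mul_one]
  unfold EE
  apply ENNReal.ofReal_le_ofReal
  rw [Real.exp_add]
  gcongr
  rw [Real.sqrt_le_left (Real.exp_pos _).le, ← Real.exp_nat_mul]
  have := Real.add_one_le_exp (((2 : ℕ) : ℝ) * (p / s))
  refine le_trans (le_of_eq ?_) this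
  push_cast
  field_simp
  rw [hsd]; ring

/-- colouring of a permutation by four colours, the last one for fixed points -/
lemma exists_coloring {I : Type*} [Fintype I] [DecidableEq I] (σ : Equiv.Perm I) :
    ∃ c : I → Fin 4, ∀ e, (c e = 3 → σ e = e) ∧ (c e ≠ 3 → c e ≠ c (σ e)) := by
  have key : ∀ T : Finset I, ∃ c : I → Fin 3, ∀ e ∈ T, σ e ∈ T → σ e ≠ e → c e ≠ c (σ e) := by
    intro T
    induction T using Finset.induction_on with
    | empty => exact ⟨fun _ => 0, by simp⟩
    | insert a T ha ih =>
      obtain ⟨c, hc⟩ := ih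
      have : ∃ k : Fin 3, k ≠ c (σ a) ∧ k ≠ c (σ⁻¹ a) := by
        generalize c (σ a) = i
        generalize c (σ⁻¹ a) = j
        revert i j; decide
      obtain ⟨k, hk1, hk2⟩ := this
      refine ⟨Function.update c a k, ?_⟩
      intro e he hse hne
      by_cases h1 : e = a
      · subst h1
        rw [Function.update_self, Function.update_of_ne hne]
        exact hk1
      · rw [Function.update_of_ne h1]
        by_cases h2 : σ e = a
        · rw [h2, Function.update_self]
          have : e = σ⁻¹ a := by rw [← h2]; simp
          rw [this]; exact hk2.symm
        · rw [Function.update_of_ne h2]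
          exact hc e (Finset.mem_of_mem_insert_of_ne he h1)
            (Finset.mem_of_mem_insert_of_ne hse h2) hne
  obtain ⟨c, hc⟩ := key Finset.univ
  refine ⟨fun e => if σ e = e then 3 else (c e).castSucc, fun e => ?_⟩
  by_cases h : σ e = e
  · simp [h]
  · have h' : σ (σ e) ≠ σ e := fun h2 => h (σ.injective h2)
    have h3 : (c e).castSucc ≠ (3 : Fin 4) := by
      generalize c e = i
      revert i; decide
    simp only [h, h', if_false]
    refine ⟨fun h4 => absurd h4 h3, fun _ h4 => ?_⟩
    exact hc e (Finset.mem_univ _) (Finset.mem_univ _) h (Fin.castSucc_injective _ h4)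

lemma pi_map_two {I : Type*} [Fintype I] {A B : Type*} [MeasurableSpace A] [MeasurableSpace B]
    (μ : Measure A) [IsProbabilityMeasure μ] (f : I → A × A → B) (hf : ∀ i, Measurable (f i)) :
    Measure.map (fun (p : (I → A) × (I → A)) i => f i (p.1 i, p.2 i))
      ((Measure.pi fun _ : I => μ).prod (Measure.pi fun _ : I => μ)) =
    Measure.pi (fun i => Measure.map (f i) (μ.prod μ)) := by
  have inst : ∀ i, IsProbabilityMeasure (Measure.map (f i) (μ.prod μ)) := fun i =>
    Measure.isProbabilityMeasure_map (hf i).aemeasurable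
  rw [← Measure.pi_map_pi (μ := fun _ : I => μ.prod μ) (f := f) (fun i => (hf i).aemeasurable)]
  rw [← (measurePreserving_arrowProdEquivProdArrow A A I (fun _ => μ) (fun _ => μ)).map_eq]
  rw [Measure.map_map]
  · rfl
  · refine measurable_pi_lambda _ fun i => (hf i).comp ?_
    fun_prop
  · exact (MeasurableEquiv.arrowProdEquivProdArrow A A I).measurable

lemma pi_merge {I : Type*} [Fintype I] [DecidableEq I] {A : Type*} [MeasurableSpace A]
    (μ : Measure A) [IsProbabilityMeasure μ] (D : Finset I) :
    Measure.map (fun (p : (I → A) × (I → A)) i => if i ∈ D then p.2 i else p.1 i)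
      ((Measure.pi fun _ : I => μ).prod (Measure.pi fun _ : I => μ)) =
    Measure.pi (fun _ => μ) := by
  have h := pi_map_two (I := I) μ (fun i (z : A × A) => if i ∈ D then z.2 else z.1) (fun i => by
    by_cases hi : i ∈ D <;> simp only [hi, if_true, if_false] <;> fun_prop)
  rw [h]
  congr 1
  ext1 i
  by_cases hi : i ∈ D
  · simp only [hi, if_true]
    exact Measure.snd_prod
  · simp only [hi, if_false]
    exact Measure.fst_prod

/-- block bound: colour class without fixed points -/
lemma block_bound {I A : Type*} [Fintype I] [DecidableEq I] [MeasurableSpace A]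
    (μ : Measure A) [IsProbabilityMeasure μ] (u : A → A → ℝ) (w w2 : A → ℝ)
    (hu : Measurable (Function.uncurry u)) (hw : Measurable w) (hw2 : Measurable w2)
    (b : ℝ) (w2n : ∀ x, 0 ≤ w2 x)
    (H2 : ∀ x, ∫⁻ x', EE (4 * u x x' + w x') ∂μ ≤ EE (b + w2 x))
    (H3 : ∫⁻ x, EE (w x + w2 x) ∂μ ≤ EE b)
    (σ : Equiv.Perm I) (M C : Finset I) (hM : ∀ e, σ e ∈ M ↔ e ∈ M) (hC : C ⊆ M)
    (hCd : ∀ e ∈ C, σ e ∉ C) :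
    ∫⁻ x, EE (∑ e ∈ C, 4 * u (x e) (x (σ e)) + ∑ e ∈ M, w (x e)) ∂(Measure.pi fun _ : I => μ)
      ≤ EE (b * M.card) := by
  set D : Finset I := C.map σ.toEmbedding with hD
  have hmemD : ∀ e, e ∈ C → σ e ∈ D := fun e he => by
    rw [hD]; exact Finset.mem_map_of_mem _ he
  have hCD : ∀ e ∈ C, e ∉ D := by
    intro e he h
    rw [hD, Finset.mem_map] at h
    obtain ⟨f, hf, rfl⟩ := h
    exact hCd f hf he
  have hDM : D ⊆ M := by
    intro e he
    rw [hD, Finset.mem_map] at he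
    obtain ⟨f, hf, rfl⟩ := he
    exact (hM f).2 (hC hf)
  have hCMD : C ⊆ M \ D := fun e he => Finset.mem_sdiff.2 ⟨hC he, hCD e he⟩
  have hu' : ∀ (f g : (I → A) × (I → A) → A), Measurable f → Measurable g →
      Measurable fun p => u (f p) (g p) := fun f g hf hg => hu.comp (hf.prodMk hg)
  have hu1 : ∀ (f g : (I → A) → A), Measurable f → Measurable g →
      Measurable fun p => u (f p) (g p) := fun f g hf hg => hu.comp (hf.prodMk hg)
  have hmeas1 : Measurable fun x : I → A =>
      EE (∑ e ∈ C, 4 * u (x e) (x (σ e)) + ∑ e ∈ M, w (x e)) := by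
    apply measurable_EE.comp
    apply Measurable.add
    · exact Finset.measurable_sum _ fun e _ => (hu1 _ _ (by fun_prop) (by fun_prop)).const_mul _
    · exact Finset.measurable_sum _ fun e _ => by fun_prop
  have hmerge : Measurable (fun (p : (I → A) × (I → A)) i => if i ∈ D then p.2 i else p.1 i) := by
    refine measurable_pi_lambda _ fun i => ?_
    by_cases hi : i ∈ D <;> simp only [hi, if_true, if_false] <;> fun_prop
  rw [← pi_merge μ D, lintegral_map hmeas1 hmerge]
  refine (lintegral_prod _ (hmeas1.comp hmerge).aemeasurable).trans_le ?_
  have step : ∀ x : I → A, ∫⁻ y, EE (∑ e ∈ C, 4 * u (if e ∈ D then y e else x e)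
        (if σ e ∈ D then y (σ e) else x (σ e)) + ∑ e ∈ M, w (if e ∈ D then y e else x e))
        ∂(Measure.pi fun _ : I => μ)
      ≤ EE (b * D.card) * ∏ e ∈ M \ D, EE (w (x e) + w2 (x e)) := by
    intro x
    have e1 : ∀ y : I → A, EE (∑ e ∈ C, 4 * u (if e ∈ D then y e else x e)
        (if σ e ∈ D then y (σ e) else x (σ e)) + ∑ e ∈ M, w (if e ∈ D then y e else x e))
        = EE (∑ e ∈ M \ D, w (x e)) *
          ∏ f ∈ D, EE (4 * u (x (σ⁻¹ f)) (y f) + w (y f)) := by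
      intro y
      rw [← EE_sum, ← EE_add]
      congr 1
      rw [Finset.sum_add_distrib]
      have a1 : ∑ e ∈ C, 4 * u (if e ∈ D then y e else x e)
        (if σ e ∈ D then y (σ e) else x (σ e)) = ∑ f ∈ D, 4 * u (x (σ⁻¹ f)) (y f) := by
        rw [hD, Finset.sum_map]
        refine Finset.sum_congr rfl fun e he => ?_
        rw [← hD, if_neg (hCD e he), if_pos (hmemD e he)]
        simp
      have a2 : ∑ e ∈ M, w (if e ∈ D then y e else x e)
          = ∑ e ∈ M \ D, w (x e) + ∑ f ∈ D, w (y f) := by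
        rw [← Finset.sum_sdiff hDM]
        congr 1
        · refine Finset.sum_congr rfl fun e he => ?_
          rw [if_neg (Finset.mem_sdiff.1 he).2]
        · refine Finset.sum_congr rfl fun e he => ?_
          rw [if_pos he]
      rw [a1, a2]; ring
    simp_rw [e1]
    have hm : ∀ f : I, Measurable fun z : A => EE (4 * u (x (σ⁻¹ f)) z + w z) := by
      intro f
      apply measurable_EE.comp
      exact ((hu.comp (measurable_const.prodMk measurable_id)).const_mul _).add hw
    rw [lintegral_const_mul]
    · rw [lintegral_pi_prod (fun _ : I => μ) D (fun f z => EE (4 * u (x (σ⁻¹ f)) z + w z)) hm]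
      have b1 : ∏ f ∈ D, ∫⁻ z, EE (4 * u (x (σ⁻¹ f)) z + w z) ∂μ
          ≤ ∏ f ∈ D, EE (b + w2 (x (σ⁻¹ f))) :=
        Finset.prod_le_prod' fun f _ => H2 _
      have b2 : ∏ f ∈ D, EE (b + w2 (x (σ⁻¹ f))) = EE (b * D.card) * EE (∑ e ∈ C, w2 (x e)) := by
        rw [← EE_sum, ← EE_add, Finset.sum_add_distrib]
        congr 2
        · simp [mul_comm]
        · rw [hD, Finset.sum_map]; simp
      have b3 : EE (∑ e ∈ C, w2 (x e)) ≤ EE (∑ e ∈ M \ D, w2 (x e)) :=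
        EE_mono (Finset.sum_le_sum_of_subset_of_nonneg hCMD fun _ _ _ => w2n _)
      calc _ ≤ EE (∑ e ∈ M \ D, w (x e)) * (EE (b * D.card) * EE (∑ e ∈ M \ D, w2 (x e))) := by
            gcongr
            exact b1.trans (b2.le.trans (by gcongr))
        _ = _ := by
            rw [← EE_sum, Finset.sum_add_distrib, EE_add]; ring
    · exact Finset.measurable_prod _ fun f _ => (hm f).comp (measurable_pi_apply f)
  refine (lintegral_mono step).trans ?_
  have hm2 : Measurable fun z : A => EE (w z + w2 z) := measurable_EE.comp (hw.add hw2)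
  have hm3 : Measurable fun x : I → A => ∏ e ∈ M \ D, EE (w (x e) + w2 (x e)) :=
    Finset.measurable_prod _ fun f _ => hm2.comp (measurable_pi_apply f)
  rw [lintegral_const_mul _ hm3,
    lintegral_pi_prod (fun _ : I => μ) (M \ D) (fun _ z => EE (w z + w2 z)) (fun _ => hm2)]
  calc _ ≤ EE (b * D.card) * ∏ e ∈ M \ D, EE b := by
        gcongr
    _ = EE (b * M.card) := by
        rw [EE_card, ← EE_add]
        congr 1
        rw [← mul_add, ← Nat.cast_add]
        congr 2
        rw [add_comm]; exact Finset.card_sdiff_add_card_eq_card hDM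

/-- block bound for fixed points -/
lemma fix_bound {I A : Type*} [Fintype I] [DecidableEq I] [MeasurableSpace A]
    (μ : Measure A) [IsProbabilityMeasure μ] (u : A → A → ℝ) (w : A → ℝ)
    (hu : Measurable (Function.uncurry u)) (hw : Measurable w)
    (b b4 : ℝ) (hb : 0 ≤ b)
    (H3 : ∫⁻ x, EE (w x) ∂μ ≤ EE b)
    (H4 : ∫⁻ x, EE (4 * u x x + w x) ∂μ ≤ EE b4)
    (M C : Finset I) (hC : C ⊆ M) :
    ∫⁻ x, EE (∑ e ∈ C, 4 * u (x e) (x e) + ∑ e ∈ M, w (x e)) ∂(Measure.pi fun _ : I => μ)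
      ≤ EE (b * M.card + b4 * C.card) := by
  have e1 : ∀ x : I → A, EE (∑ e ∈ C, 4 * u (x e) (x e) + ∑ e ∈ M, w (x e)) =
      ∏ e ∈ M, EE ((if e ∈ C then 4 * u (x e) (x e) else 0) + w (x e)) := by
    intro x
    rw [← EE_sum, Finset.sum_add_distrib]
    congr 2
    rw [← Finset.sum_filter, Finset.filter_mem_eq_inter, Finset.inter_eq_right.2 hC]
  simp_rw [e1]
  have hm : ∀ e : I, Measurable fun z => EE ((if e ∈ C then 4 * u z z else 0) + w z) := by
    intro e
    apply measurable_EE.comp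
    refine Measurable.add ?_ hw
    by_cases he : e ∈ C <;> simp only [he, if_true, if_false]
    · exact (hu.comp (measurable_id.prodMk measurable_id)).const_mul _
    · exact measurable_const
  rw [lintegral_pi_prod (fun _ : I => μ) M
    (fun e z => EE ((if e ∈ C then 4 * u z z else 0) + w z)) hm]
  calc _ ≤ ∏ e ∈ M, EE (b + if e ∈ C then b4 else 0) := by
        refine Finset.prod_le_prod' fun e _ => ?_
        by_cases he : e ∈ C <;> simp only [he, if_true, if_false]
        · exact H4.trans (EE_mono (by linarith))
        · simpa using H3
    _ = _ := by
        rw [← EE_sum, Finset.sum_add_distrib]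
        congr 2
        · simp [mul_comm]
        · rw [← Finset.sum_filter, Finset.filter_mem_eq_inter, Finset.inter_eq_right.2 hC]
          simp [mul_comm]

lemma exp_four (A : Fin 4 → ℝ) (B : ℝ) :
    Real.exp (∑ j, A j + B) ≤ ∑ j, (1 / 4) * Real.exp (4 * A j + B) := by
  have h := convexOn_exp.map_sum_le (t := Finset.univ) (w := fun _ : Fin 4 => (1 / 4 : ℝ))
    (p := fun j => 4 * A j + B) (fun _ _ => by norm_num) (by simp) (fun _ _ => Set.mem_univ _)
  simp only [smul_eq_mul] at h
  refine le_trans (le_of_eq ?_) h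
  congr 1
  simp only [Fin.sum_univ_four]; ring

theorem mgf_abs {I A : Type*} [Fintype I] [DecidableEq I] [MeasurableSpace A]
    (μ : Measure A) [IsProbabilityMeasure μ] (h : A → A → A) (hh : Measurable (Function.uncurry h))
    (g u : A → A → ℝ) (w w2 : A → ℝ) (hg : Measurable (Function.uncurry g))
    (hu : Measurable (Function.uncurry u)) (hw : Measurable w) (hw2 : Measurable w2)
    (b b4 : ℝ) (hb : 0 ≤ b) (hb4 : 0 ≤ b4) (w2n : ∀ x, 0 ≤ w2 x)
    (H1 : ∀ x x', ∫⁻ z, EE (g x (h x' z)) ∂μ ≤ EE (u x x' + w x))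
    (H2 : ∀ x, ∫⁻ x', EE (4 * u x x' + w x') ∂μ ≤ EE (b + w2 x))
    (H3 : ∫⁻ x, EE (w x + w2 x) ∂μ ≤ EE b)
    (H4 : ∫⁻ x, EE (4 * u x x + w x) ∂μ ≤ EE b4)
    (σ : Equiv.Perm I) (M : Finset I) (hM : ∀ e, σ e ∈ M ↔ e ∈ M) :
    ∫⁻ ω, EE (∑ e ∈ M, g (ω e).1 (ω (σ e)).2)
      ∂(Measure.pi fun _ : I => Measure.map (fun z : A × A => (z.1, h z.1 z.2)) (μ.prod μ))
      ≤ EE (b * M.card + b4 * (M.filter fun e => σ e = e).card) := by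
  have hΦ : Measurable (fun z : A × A => (z.1, h z.1 z.2)) := measurable_fst.prodMk hh
  rw [← pi_map_two μ (fun _ : I => fun z : A × A => (z.1, h z.1 z.2)) (fun _ => hΦ)]
  have hm1 : Measurable fun ω : I → A × A => EE (∑ e ∈ M, g (ω e).1 (ω (σ e)).2) := by
    apply measurable_EE.comp
    refine Finset.measurable_sum _ fun e _ => ?_
    have h0 : Measurable fun ω : I → A × A => ((ω e).1, (ω (σ e)).2) := by fun_prop
    exact hg.comp h0
  have hm2 : Measurable (fun (p : (I → A) × (I → A)) (i : I) => (p.1 i, h (p.1 i) (p.2 i))) := by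
    refine measurable_pi_lambda _ fun i => ?_
    have h0 : Measurable fun p : (I → A) × (I → A) => (p.1 i, p.2 i) := by fun_prop
    exact hΦ.comp h0
  rw [lintegral_map hm1 hm2]
  refine (lintegral_prod _ (hm1.comp hm2).aemeasurable).trans_le ?_
  have reix : ∀ F : I → ℝ, ∑ e ∈ M, F (σ e) = ∑ f ∈ M, F f := by
    intro F
    refine Finset.sum_bij (fun e _ => σ e) (fun e he => (hM e).2 he)
      (fun _ _ _ _ h => σ.injective h) (fun f hf => ⟨σ⁻¹ f, ?_, by simp⟩) (fun _ _ => rfl)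
    rw [← hM]; simpa using hf
  have step : ∀ x : I → A, ∫⁻ z, EE (∑ e ∈ M, g (x e) (h (x (σ e)) (z (σ e))))
      ∂(Measure.pi fun _ : I => μ) ≤ EE (∑ e ∈ M, u (x e) (x (σ e)) + ∑ e ∈ M, w (x e)) := by
    intro x
    have e1 : ∀ z : I → A, EE (∑ e ∈ M, g (x e) (h (x (σ e)) (z (σ e))))
        = ∏ f ∈ M, EE (g (x (σ⁻¹ f)) (h (x f) (z f))) := by
      intro z
      rw [← EE_sum, ← reix fun f => g (x (σ⁻¹ f)) (h (x f) (z f))]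
      simp
    simp_rw [e1]
    have hm3 : ∀ f : I, Measurable fun z => EE (g (x (σ⁻¹ f)) (h (x f) z)) := by
      intro f
      apply measurable_EE.comp
      exact hg.comp (measurable_const.prodMk (hh.comp (measurable_const.prodMk measurable_id)))
    rw [lintegral_pi_prod (fun _ : I => μ) M
      (fun f z => EE (g (x (σ⁻¹ f)) (h (x f) z))) hm3]
    calc _ ≤ ∏ f ∈ M, EE (u (x (σ⁻¹ f)) (x f) + w (x (σ⁻¹ f))) :=
          Finset.prod_le_prod' fun f _ => H1 _ _
      _ = _ := by
          rw [← EE_sum, ← reix, ← Finset.sum_add_distrib]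
          simp
  refine (lintegral_mono step).trans ?_
  obtain ⟨c, hc⟩ := exists_coloring σ
  set N : ℝ := b * M.card + b4 * (M.filter fun e => σ e = e).card with hN
  have hcol : ∀ x : I → A, EE (∑ e ∈ M, u (x e) (x (σ e)) + ∑ e ∈ M, w (x e)) ≤
      ∑ j : Fin 4, ENNReal.ofReal (1 / 4) *
        EE (∑ e ∈ M.filter (fun e => c e = j), 4 * u (x e) (x (σ e)) + ∑ e ∈ M, w (x e)) := by
    intro x
    have := exp_four (fun j => ∑ e ∈ M.filter (fun e => c e = j), u (x e) (x (σ e)))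
      (∑ e ∈ M, w (x e))
    rw [Finset.sum_fiberwise] at this
    unfold EE
    refine (ENNReal.ofReal_le_ofReal this).trans (le_of_eq ?_)
    rw [ENNReal.ofReal_sum_of_nonneg (fun _ _ => by positivity)]
    refine Finset.sum_congr rfl fun j _ => ?_
    rw [ENNReal.ofReal_mul (by norm_num), Finset.mul_sum]
  have hm4 : ∀ j : Fin 4, Measurable fun x : I → A =>
      EE (∑ e ∈ M.filter (fun e => c e = j), 4 * u (x e) (x (σ e)) + ∑ e ∈ M, w (x e)) := by
    intro j
    apply measurable_EE.comp
    apply Measurable.add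
    · refine Finset.measurable_sum _ fun e _ => Measurable.const_mul ?_ _
      exact hu.comp (Measurable.prodMk (by fun_prop) (by fun_prop))
    · exact Finset.measurable_sum _ fun e _ => by fun_prop
  have hcls : ∀ j : Fin 4, ∫⁻ x, EE (∑ e ∈ M.filter (fun e => c e = j), 4 * u (x e) (x (σ e))
      + ∑ e ∈ M, w (x e)) ∂(Measure.pi fun _ : I => μ) ≤ EE N := by
    intro j
    by_cases hj : j = 3
    · have hsub : M.filter (fun e => c e = j) ⊆ M.filter (fun e => σ e = e) := by
        intro e he
        rw [Finset.mem_filter] at he ⊢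
        exact ⟨he.1, (hc e).1 (he.2.trans hj)⟩
      have hfe : ∀ x : I → A, ∑ e ∈ M.filter (fun e => c e = j), 4 * u (x e) (x (σ e))
          = ∑ e ∈ M.filter (fun e => c e = j), 4 * u (x e) (x e) := by
        intro x
        refine Finset.sum_congr rfl fun e he => ?_
        rw [(Finset.mem_filter.1 (hsub he)).2]
      simp_rw [hfe]
      refine (fix_bound μ u w hu hw b b4 hb ((lintegral_mono fun x => EE_mono ?_).trans H3) H4 M _
        (Finset.filter_subset _ _)).trans (EE_mono ?_)
      · linarith [w2n x]
      · rw [hN]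
        have : ((M.filter (fun e => c e = j)).card : ℝ) ≤ (M.filter (fun e => σ e = e)).card := by
          exact_mod_cast Finset.card_le_card hsub
        nlinarith
    · refine (block_bound μ u w w2 hu hw hw2 b w2n H2 H3 σ M _ hM (Finset.filter_subset _ _)
        ?_).trans (EE_mono ?_)
      · intro e he h2
        rw [Finset.mem_filter] at he h2
        exact (hc e).2 (by rw [he.2]; exact hj) (he.2.trans h2.2.symm)
      · rw [hN]
        have : 0 ≤ b4 * ((M.filter (fun e => σ e = e)).card : ℝ) := by positivity
        linarith
  calc _ ≤ ∫⁻ x, ∑ j : Fin 4, ENNReal.ofReal (1 / 4) *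
        EE (∑ e ∈ M.filter (fun e => c e = j), 4 * u (x e) (x (σ e)) + ∑ e ∈ M, w (x e))
          ∂(Measure.pi fun _ : I => μ) := lintegral_mono hcol
    _ = ∑ j : Fin 4, ENNReal.ofReal (1 / 4) * ∫⁻ x, 
        EE (∑ e ∈ M.filter (fun e => c e = j), 4 * u (x e) (x (σ e)) + ∑ e ∈ M, w (x e))
          ∂(Measure.pi fun _ : I => μ) := by
        rw [lintegral_finsetSum _ fun j _ => (hm4 j).const_mul _]
        refine Finset.sum_congr rfl fun j _ => ?_
        rw [lintegral_const_mul _ (hm4 j)]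
    _ ≤ ∑ j : Fin 4, ENNReal.ofReal (1 / 4) * EE N := by
        refine Finset.sum_le_sum fun j _ => ?_
        gcongr
        exact hcls j
    _ = EE N := by
        rw [← Finset.sum_mul]
        have : ∑ _j : Fin 4, ENNReal.ofReal (1 / 4) = 1 := by
          rw [← ENNReal.ofReal_sum_of_nonneg (fun _ _ => by norm_num)]
          norm_num
        rw [this, one_mul]

lemma vec_int {d : ℕ} (F : Fin d → ℝ → ℝ) (hF : ∀ i, Measurable (F i)) (G : Fin d → ℝ)
    (h : ∀ i, ∫⁻ z, EE (F i z) ∂(gaussianReal 0 1) ≤ EE (G i)) :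
    ∫⁻ x, EE (∑ i, F i (x i)) ∂(Measure.pi fun _ : Fin d => gaussianReal 0 1) ≤ EE (∑ i, G i) := by
  simp_rw [EE_sum]
  rw [lintegral_pi_prod (fun _ : Fin d => gaussianReal 0 1) Finset.univ (fun i z => EE (F i z))
    (fun i => measurable_EE.comp (hF i))]
  exact Finset.prod_le_prod' fun i _ => h i

/-- parameter regime -/
structure Par (t a ρ : ℝ) : Prop where
  ht : 0 < t
  ht1 : t ≤ 1 / 100
  ha : 0 < a
  haρ : a ≤ ρ
  hac : a ≤ t / 100
  hρ1 : ρ < 1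

lemma sH1 {t a ρ : ℝ} (P : Par t a ρ) (x x' : ℝ) :
    ∫⁻ z, EE (a * (x * (ρ * x' + Real.sqrt (1 - ρ ^ 2) * z))) ∂(gaussianReal 0 1)
      ≤ EE (a * ρ * (x * x') + a ^ 2 / 2 * x ^ 2) := by
  have hρ0 : 0 < ρ := P.ha.trans_le P.haρ
  have e : ∀ z, EE (a * (x * (ρ * x' + Real.sqrt (1 - ρ ^ 2) * z))) =
      EE (a * ρ * (x * x')) * EE (0 * z ^ 2 + (a * x * Real.sqrt (1 - ρ ^ 2)) * z) := by
    intro z; rw [← EE_add]; congr 1; ring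
  simp_rw [e]
  rw [lintegral_const_mul _ (by fun_prop), EE_add]
  gcongr
  refine (gint_le _ _ (by norm_num)).trans (EE_mono ?_)
  rw [mul_pow, Real.sq_sqrt (by nlinarith [P.hρ1])]
  have : 0 ≤ (a * x) ^ 2 * ρ ^ 2 := by positivity
  simp only [mul_zero, sub_zero, zero_div, zero_add, mul_one]
  nlinarith

lemma par_sq {t a ρ : ℝ} (P : Par t a ρ) : a ^ 2 ≤ a * ρ ∧ a ^ 2 ≤ 1 / 100000 ∧
    a * ρ ≤ t / 100 ∧ a ^ 2 * ρ ^ 2 ≤ a * ρ * (t / 100) ∧ 0 < a * ρ ∧ a ^ 2 * ρ ^ 2 ≤ a ^ 2 ∧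
    a ^ 2 ≤ (t / 100) ^ 2 := by
  obtain ⟨ht, ht1, ha, haρ, hac, hρ1⟩ := P
  have hρ0 : 0 < ρ := ha.trans_le haρ
  have h1 : a * ρ ≤ a := by nlinarith
  have h5 : 0 < a * ρ := by positivity
  refine ⟨by nlinarith, by nlinarith, by linarith, ?_, h5, ?_, by gcongr⟩
  · have : a ^ 2 * ρ ^ 2 = a * ρ * (a * ρ) := by ring
    rw [this]
    gcongr
    linarith
  · nlinarith [sq_nonneg a]

lemma sH2 {t a ρ : ℝ} (P : Par t a ρ) (x : ℝ) :
    ∫⁻ x', EE (4 * (a * ρ * (x * x')) + a ^ 2 / 2 * x' ^ 2) ∂(gaussianReal 0 1)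
      ≤ EE (a * ρ * (1 / 2 + t) + 8 * (a ^ 2 * ρ ^ 2) / (1 - a ^ 2) * x ^ 2) := by
  obtain ⟨h1, h2, h3, h4, h5, h6, h7⟩ := par_sq P
  have e : ∀ x', EE (4 * (a * ρ * (x * x')) + a ^ 2 / 2 * x' ^ 2) =
      EE (a ^ 2 / 2 * x' ^ 2 + (4 * (a * ρ * x)) * x') := by
    intro z; congr 1; ring
  simp_rw [e]
  refine (gint_le _ _ (by linarith)).trans (EE_mono ?_)
  have hpos : 0 < 1 - a ^ 2 := by linarith
  have e1 : 1 - 2 * (a ^ 2 / 2) = 1 - a ^ 2 := by ring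
  rw [e1]
  have e2 : (4 * (a * ρ * x)) ^ 2 / (2 * (1 - a ^ 2)) = 8 * (a ^ 2 * ρ ^ 2) / (1 - a ^ 2) * x ^ 2 := by
    field_simp; ring
  rw [e2]
  gcongr
  rw [div_le_iff₀ hpos]
  have ht := P.ht
  have ht1 := P.ht1
  have : a ^ 2 ≤ t / 100 := by nlinarith
  have k1 : 1 / 2 ≤ (1 / 2 + t) * (1 - a ^ 2) := by nlinarith
  calc a ^ 2 / 2 ≤ a * ρ * (1 / 2) := by linarith
    _ ≤ a * ρ * ((1 / 2 + t) * (1 - a ^ 2)) := by gcongr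
    _ = _ := by ring

lemma sH3 {t a ρ : ℝ} (P : Par t a ρ) :
    ∫⁻ x, EE (a ^ 2 / 2 * x ^ 2 + 8 * (a ^ 2 * ρ ^ 2) / (1 - a ^ 2) * x ^ 2) ∂(gaussianReal 0 1)
      ≤ EE (a * ρ * (1 / 2 + t)) := by
  obtain ⟨h1, h2, h3, h4, h5, h6, h7⟩ := par_sq P
  have hpos : 0 < 1 - a ^ 2 := by linarith
  have ht := P.ht
  have ht1 := P.ht1
  set p := a ^ 2 / 2 + 8 * (a ^ 2 * ρ ^ 2) / (1 - a ^ 2) with hp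
  have q1 : 8 * (a ^ 2 * ρ ^ 2) / (1 - a ^ 2) ≤ 9 * (a ^ 2 * ρ ^ 2) := by
    rw [div_le_iff₀ hpos]
    have : 0 ≤ a ^ 2 * ρ ^ 2 := by positivity
    nlinarith
  have p1 : p ≤ a * ρ * (1 / 2 + 9 * (t / 100)) := by rw [hp]; linarith
  have p2 : p ≤ 10 * (t / 100) ^ 2 := by rw [hp]; linarith [sq_nonneg (t / 100)]
  have p3 : p ≤ t / 100 := by nlinarith
  have e : ∀ x, EE (a ^ 2 / 2 * x ^ 2 + 8 * (a ^ 2 * ρ ^ 2) / (1 - a ^ 2) * x ^ 2) =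
      EE (p * x ^ 2 + 0 * x) := by
    intro z; congr 1; rw [hp]; ring
  simp_rw [e]
  refine (gint_le _ _ (by linarith)).trans (EE_mono ?_)
  have hs : 0 < 1 - 2 * p := by linarith
  simp only [ne_eq, OfNat.ofNat_ne_zero, not_false_eq_true, zero_pow, zero_div, add_zero]
  rw [div_le_iff₀ hs]
  have k1 : 1 / 2 + 9 * (t / 100) ≤ (1 / 2 + t) * (1 - 2 * p) := by nlinarith
  calc p ≤ a * ρ * (1 / 2 + 9 * (t / 100)) := p1
    _ ≤ a * ρ * ((1 / 2 + t) * (1 - 2 * p)) := by gcongr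
    _ = _ := by ring

lemma sH4 {t a ρ : ℝ} (P : Par t a ρ) :
    ∫⁻ x, EE (4 * (a * ρ * (x * x)) + a ^ 2 / 2 * x ^ 2) ∂(gaussianReal 0 1) ≤ EE 1 := by
  obtain ⟨h1, h2, h3, h4, h5, h6, h7⟩ := par_sq P
  have ht := P.ht
  have ht1 := P.ht1
  have e : ∀ x, EE (4 * (a * ρ * (x * x)) + a ^ 2 / 2 * x ^ 2) =
      EE ((4 * (a * ρ) + a ^ 2 / 2) * x ^ 2 + 0 * x) := by
    intro z; congr 1; ring
  simp_rw [e]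
  refine (gint_le _ _ (by linarith)).trans (EE_mono ?_)
  simp only [ne_eq, OfNat.ofNat_ne_zero, not_false_eq_true, zero_pow, zero_div, add_zero]
  rw [div_le_iff₀ (by linarith)]
  linarith

lemma edges_mgf {I : Type*} [Fintype I] [DecidableEq I] {t a ρ : ℝ} (P : Par t a ρ)
    (σ : Equiv.Perm I) (M : Finset I) (hM : ∀ e, σ e ∈ M ↔ e ∈ M) :
    ∫⁻ ω, EE (∑ e ∈ M, a * ((ω e).1 * (ω (σ e)).2)) ∂(Measure.pi fun _ : I => gaussianPair ρ)
      ≤ EE (a * ρ * (1 / 2 + t) * M.card + 1 * (M.filter fun e => σ e = e).card) := by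
  obtain ⟨h1, h2, h3, h4, h5, h6, h7⟩ := par_sq P
  have ht := P.ht
  have hpos : 0 < 1 - a ^ 2 := by linarith
  exact mgf_abs (gaussianReal 0 1) (fun x z => ρ * x + Real.sqrt (1 - ρ ^ 2) * z)
    (by unfold Function.uncurry; fun_prop)
    (fun x y => a * (x * y)) (fun x x' => a * ρ * (x * x')) (fun x => a ^ 2 / 2 * x ^ 2)
    (fun x => 8 * (a ^ 2 * ρ ^ 2) / (1 - a ^ 2) * x ^ 2)
    (by unfold Function.uncurry; fun_prop) (by unfold Function.uncurry; fun_prop)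
    (by fun_prop) (by fun_prop) _ _ (by positivity) (by norm_num) (fun x => by positivity)
    (sH1 P) (sH2 P) (sH3 P) (sH4 P) σ M hM

lemma feat_mgf {I : Type*} [Fintype I] [DecidableEq I] {d : ℕ} {t a ρ : ℝ} (P : Par t a ρ)
    (σ : Equiv.Perm I) (M : Finset I) (hM : ∀ e, σ e ∈ M ↔ e ∈ M) :
    ∫⁻ ω, EE (∑ e ∈ M, ∑ i : Fin d, a * ((ω e).1 i * (ω (σ e)).2 i))
        ∂(Measure.pi fun _ : I => featurePair d ρ)
      ≤ EE (∑ _i : Fin d, a * ρ * (1 / 2 + t) * M.card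
          + (∑ _i : Fin d, 1) * (M.filter fun e => σ e = e).card) := by
  obtain ⟨h1, h2, h3, h4, h5, h6, h7⟩ := par_sq P
  have ht := P.ht
  have hpos : 0 < 1 - a ^ 2 := by linarith
  rw [← Finset.sum_mul]
  refine mgf_abs (Measure.pi fun _ : Fin d => gaussianReal 0 1)
    (fun x z => fun i => ρ * x i + Real.sqrt (1 - ρ ^ 2) * z i)
    (by unfold Function.uncurry; fun_prop)
    (fun x y => ∑ i : Fin d, a * (x i * y i)) (fun x x' => ∑ i : Fin d, a * ρ * (x i * x' i))
    (fun x => ∑ i : Fin d, a ^ 2 / 2 * x i ^ 2)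
    (fun x => ∑ i : Fin d, 8 * (a ^ 2 * ρ ^ 2) / (1 - a ^ 2) * x i ^ 2)
    (by unfold Function.uncurry; fun_prop) (by unfold Function.uncurry; fun_prop)
    (by fun_prop) (by fun_prop) _ _ (Finset.sum_nonneg fun _ _ => by positivity)
    (Finset.sum_nonneg fun _ _ => by norm_num)
    (fun x => Finset.sum_nonneg fun _ _ => by positivity) ?_ ?_ ?_ ?_ σ M hM
  · intro x x'
    rw [← Finset.sum_add_distrib]
    exact vec_int (fun i z => a * (x i * (ρ * x' i + Real.sqrt (1 - ρ ^ 2) * z)))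
      (fun i => by fun_prop) _ (fun i => sH1 P _ _)
  · intro x
    simp_rw [Finset.mul_sum, ← Finset.sum_add_distrib]
    exact vec_int (fun i z => 4 * (a * ρ * (x i * z)) + a ^ 2 / 2 * z ^ 2)
      (fun i => by fun_prop) _ (fun i => sH2 P _)
  · simp_rw [← Finset.sum_add_distrib]
    exact vec_int (fun i z => a ^ 2 / 2 * z ^ 2 + 8 * (a ^ 2 * ρ ^ 2) / (1 - a ^ 2) * z ^ 2)
      (fun i => by fun_prop) _ (fun i => sH3 P)
  · simp_rw [Finset.mul_sum, ← Finset.sum_add_distrib]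
    exact vec_int (fun i z => 4 * (a * ρ * (z * z)) + a ^ 2 / 2 * z ^ 2)
      (fun i => by fun_prop) _ (fun i => sH4 P)

lemma sL1 {t a ρ : ℝ} (P : Par t a ρ) (x : ℝ) :
    ∫⁻ z, EE (-(t / 2) * (a * (x * (ρ * x + Real.sqrt (1 - ρ ^ 2) * z)))) ∂(gaussianReal 0 1)
      ≤ EE (-(t / 2 * (a * ρ) * (1 - t / 4)) * x ^ 2) := by
  obtain ⟨h1, h2, h3, h4, h5, h6, h7⟩ := par_sq P
  have ht := P.ht
  have hρ0 : 0 < ρ := P.ha.trans_le P.haρ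
  have e : ∀ z, EE (-(t / 2) * (a * (x * (ρ * x + Real.sqrt (1 - ρ ^ 2) * z)))) =
      EE (-(t / 2) * (a * ρ) * x ^ 2) *
        EE (0 * z ^ 2 + (-(t / 2) * a * x * Real.sqrt (1 - ρ ^ 2)) * z) := by
    intro z; rw [← EE_add]; congr 1; ring
  simp_rw [e]
  rw [lintegral_const_mul _ (by fun_prop)]
  refine (mul_le_mul_right (gint_le _ _ (by norm_num)) _).trans ?_
  rw [← EE_add]
  refine EE_mono ?_
  rw [mul_pow, Real.sq_sqrt (by nlinarith [P.hρ1])]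
  simp only [mul_zero, sub_zero, zero_div, zero_add, mul_one]
  have k : (-(t / 2) * a * x) ^ 2 * (1 - ρ ^ 2) ≤ (t / 2) ^ 2 * (a * ρ) * x ^ 2 := by
    calc (-(t / 2) * a * x) ^ 2 * (1 - ρ ^ 2) = (t / 2) ^ 2 * x ^ 2 * (a ^ 2 - a ^ 2 * ρ ^ 2) := by
          ring
      _ ≤ (t / 2) ^ 2 * x ^ 2 * (a * ρ) := by
          have : 0 ≤ a ^ 2 * ρ ^ 2 := by positivity
          gcongr; linarith
      _ = _ := by ring
  nlinarith

lemma sL2 {t a ρ : ℝ} (P : Par t a ρ) :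
    ∫⁻ x, EE (-(t / 2 * (a * ρ) * (1 - t / 4)) * x ^ 2) ∂(gaussianReal 0 1)
      ≤ EE (-(t / 2 * (a * ρ) * (1 - t / 2))) := by
  obtain ⟨h1, h2, h3, h4, h5, h6, h7⟩ := par_sq P
  have ht := P.ht
  have ht1 := P.ht1
  set p := t / 2 * (a * ρ) * (1 - t / 4) with hp
  have hp0 : 0 ≤ p := by rw [hp]; have : 0 ≤ 1 - t / 4 := by linarith
                         positivity
  have e : ∀ x, EE (-p * x ^ 2) = EE (-p * x ^ 2 + 0 * x) := by
    intro z; congr 1; ring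
  simp_rw [e]
  refine (gint_le _ _ (by linarith)).trans (EE_mono ?_)
  simp only [ne_eq, OfNat.ofNat_ne_zero, not_false_eq_true, zero_pow, zero_div, add_zero]
  rw [div_le_iff₀ (by linarith)]
  have hp1 : p ≤ t / 100 := by
    rw [hp]
    have : t / 2 * (a * ρ) ≤ t / 100 * 1 := by nlinarith
    nlinarith
  have k : (1 - t / 2) * (1 + 2 * p) ≤ 1 - t / 4 := by nlinarith
  have : t / 2 * (a * ρ) * ((1 - t / 2) * (1 + 2 * p)) ≤ t / 2 * (a * ρ) * (1 - t / 4) := by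
    gcongr
  nlinarith

lemma pair_low {t a ρ : ℝ} (P : Par t a ρ) :
    ∫⁻ w, EE (-(t / 2) * (a * (w.1 * w.2))) ∂(gaussianPair ρ)
      ≤ EE (-(t / 2 * (a * ρ) * (1 - t / 2))) := by
  unfold gaussianPair
  rw [lintegral_map (by fun_prop) (by fun_prop)]
  refine (lintegral_prod _ (by fun_prop)).trans_le ?_
  exact (lintegral_mono fun x => sL1 P x).trans (sL2 P)

lemma feat_low {d : ℕ} {t a ρ : ℝ} (P : Par t a ρ) :
    ∫⁻ w, EE (∑ i : Fin d, -(t / 2) * (a * (w.1 i * w.2 i))) ∂(featurePair d ρ)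
      ≤ EE (∑ _i : Fin d, -(t / 2 * (a * ρ) * (1 - t / 2))) := by
  have step : ∀ x : Fin d → ℝ, ∫⁻ z, EE (∑ i : Fin d, -(t / 2) *
      (a * (x i * (ρ * x i + Real.sqrt (1 - ρ ^ 2) * z i))))
      ∂(Measure.pi fun _ : Fin d => gaussianReal 0 1) ≤
      EE (∑ i : Fin d, -(t / 2 * (a * ρ) * (1 - t / 4)) * x i ^ 2) := fun x => vec_int
    (fun i z => -(t / 2) * (a * (x i * (ρ * x i + Real.sqrt (1 - ρ ^ 2) * z))))
    (fun i => by fun_prop) _ (fun i => sL1 P (x i))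
  have step2 : ∫⁻ x, EE (∑ i : Fin d, -(t / 2 * (a * ρ) * (1 - t / 4)) * x i ^ 2)
      ∂(Measure.pi fun _ : Fin d => gaussianReal 0 1) ≤
      EE (∑ _i : Fin d, -(t / 2 * (a * ρ) * (1 - t / 2))) :=
    vec_int (fun _ z => -(t / 2 * (a * ρ) * (1 - t / 4)) * z ^ 2) (fun i => by fun_prop) _
      (fun i => sL2 P)
  unfold featurePair
  rw [lintegral_map (by fun_prop) (by fun_prop)]
  rw [lintegral_prod _ (by fun_prop)]
  exact (lintegral_mono step).trans step2

instance (ρ : ℝ) : IsProbabilityMeasure (gaussianPair ρ) := by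
  unfold gaussianPair
  exact Measure.isProbabilityMeasure_map (by fun_prop)

instance (d : ℕ) (ρ : ℝ) : IsProbabilityMeasure (featurePair d ρ) := by
  unfold featurePair
  exact Measure.isProbabilityMeasure_map (by fun_prop)

instance (n d : ℕ) (ρ r : ℝ) : IsProbabilityMeasure (sample n d ρ r) := by
  unfold sample
  infer_instance

lemma edges_low {I : Type*} [Fintype I] {t a ρ : ℝ} (P : Par t a ρ) (M : Finset I) :
    ∫⁻ ω, EE (∑ e ∈ M, -(t / 2) * (a * ((ω e).1 * (ω e).2)))
      ∂(Measure.pi fun _ : I => gaussianPair ρ)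
      ≤ EE (-(t / 2 * (a * ρ) * (1 - t / 2)) * M.card) := by
  simp_rw [EE_sum]
  rw [lintegral_pi_prod (fun _ : I => gaussianPair ρ) M
    (fun _ w => EE (-(t / 2) * (a * (w.1 * w.2)))) (fun _ => by fun_prop), ← EE_card]
  exact Finset.prod_le_prod' fun _ _ => pair_low P

lemma feats_low {I : Type*} [Fintype I] {d : ℕ} {t a ρ : ℝ} (P : Par t a ρ) (M : Finset I) :
    ∫⁻ ω, EE (∑ e ∈ M, ∑ i : Fin d, -(t / 2) * (a * ((ω e).1 i * (ω e).2 i)))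
      ∂(Measure.pi fun _ : I => featurePair d ρ)
      ≤ EE ((∑ _i : Fin d, -(t / 2 * (a * ρ) * (1 - t / 2))) * M.card) := by
  simp_rw [EE_sum M]
  rw [lintegral_pi_prod (fun _ : I => featurePair d ρ) M
    (fun _ w => EE (∑ i : Fin d, -(t / 2) * (a * (w.1 i * w.2 i)))) (fun _ => by fun_prop),
    ← EE_card]
  exact Finset.prod_le_prod' fun _ _ => feat_low P

/-- the permutation of edges induced by a vertex permutation -/
def edgePerm {n : ℕ} (σ : Equiv.Perm (Fin n)) : Equiv.Perm (Edge n) where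
  toFun := edgeMap σ
  invFun := edgeMap σ⁻¹
  left_inv e := by
    apply Subtype.ext
    simp only [edgeMap, Sym2.map_map]
    have : (⇑σ⁻¹ ∘ ⇑σ) = id := by funext x; simp
    rw [this, Sym2.map_id]; rfl
  right_inv e := by
    apply Subtype.ext
    simp only [edgeMap, Sym2.map_map]
    have : (⇑σ ∘ ⇑σ⁻¹) = id := by funext x; simp
    rw [this, Sym2.map_id]; rfl

abbrev Om (n d : ℕ) := (Edge n → ℝ × ℝ) × (Fin n → (Fin d → ℝ) × (Fin d → ℝ))

/-- edges touching a set of vertices -/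
def Me {n : ℕ} (S : Finset (Fin n)) : Finset (Edge n) :=
  Finset.univ.filter fun e => ∃ v ∈ S, v ∈ e.1

/-- restricted score -/
noncomputable def SM {n d : ℕ} (a b : ℝ) (M : Finset (Edge n)) (S : Finset (Fin n))
    (σ : Equiv.Perm (Fin n)) (ω : Om n d) : ℝ :=
  ∑ e ∈ M, a * ((ω.1 e).1 * (ω.1 (edgePerm σ e)).2) +
    ∑ v ∈ S, ∑ i : Fin d, b * ((ω.2 v).1 i * (ω.2 (σ v)).2 i)

lemma edgePerm_fix {n : ℕ} (σ : Equiv.Perm (Fin n)) (e : Edge n) (he : e ∉ Me σ.support) :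
    edgePerm σ e = e := by
  apply Subtype.ext
  change Sym2.map σ e.1 = e.1
  have : ∀ v ∈ e.1, σ v = id v := by
    intro v hv
    by_contra h
    apply he
    simp only [Me, Finset.mem_filter, Finset.mem_univ, true_and]
    exact ⟨v, Equiv.Perm.mem_support.2 h, hv⟩
  rw [Sym2.map_congr this, Sym2.map_id]; rfl

lemma edgePerm_one {n : ℕ} (e : Edge n) : edgePerm (1 : Equiv.Perm (Fin n)) e = e := by
  apply edgePerm_fix
  simp [Me]

lemma edgePerm_mem {n : ℕ} (σ : Equiv.Perm (Fin n)) (e : Edge n) :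
    edgePerm σ e ∈ Me σ.support ↔ e ∈ Me σ.support := by
  simp only [Me, Finset.mem_filter, Finset.mem_univ, true_and]
  change (∃ v ∈ σ.support, v ∈ Sym2.map σ e.1) ↔ _
  constructor
  · rintro ⟨v, hv, hve⟩
    obtain ⟨u, hu, rfl⟩ := Sym2.mem_map.1 hve
    exact ⟨u, Equiv.Perm.apply_mem_support.1 hv, hu⟩
  · rintro ⟨v, hv, hve⟩
    exact ⟨σ v, Equiv.Perm.apply_mem_support.2 hv, Sym2.mem_map.2 ⟨v, hve, rfl⟩⟩

lemma score_restrict {n d : ℕ} (a b : ℝ) (σ : Equiv.Perm (Fin n)) (ω : Om n d)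
    (h : SM a b Finset.univ Finset.univ 1 ω ≤ SM a b Finset.univ Finset.univ σ ω) :
    SM a b (Me σ.support) σ.support 1 ω ≤ SM a b (Me σ.support) σ.support σ ω := by
  unfold SM at *
  rw [← Finset.sum_sdiff (Finset.subset_univ (Me σ.support)),
    ← Finset.sum_sdiff (Finset.subset_univ (σ.support)),
    ← Finset.sum_sdiff (Finset.subset_univ (Me σ.support)),
    ← Finset.sum_sdiff (Finset.subset_univ (σ.support))] at h
  have e1 : ∑ e ∈ Finset.univ \ Me σ.support, a * ((ω.1 e).1 * (ω.1 (edgePerm σ e)).2)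
      = ∑ e ∈ Finset.univ \ Me σ.support, a * ((ω.1 e).1 * (ω.1 (edgePerm 1 e)).2) := by
    refine Finset.sum_congr rfl fun e he => ?_
    rw [edgePerm_fix σ e (Finset.mem_sdiff.1 he).2, edgePerm_one]
  have e2 : ∑ v ∈ Finset.univ \ σ.support, ∑ i : Fin d, b * ((ω.2 v).1 i * (ω.2 (σ v)).2 i)
      = ∑ v ∈ Finset.univ \ σ.support, ∑ i : Fin d,
        b * ((ω.2 v).1 i * (ω.2 ((1 : Equiv.Perm (Fin n)) v)).2 i) := by
    refine Finset.sum_congr rfl fun v hv => ?_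
    have := (Finset.mem_sdiff.1 hv).2
    rw [Equiv.Perm.notMem_support] at this
    rw [this]; rfl
  rw [e1, e2] at h
  linarith

lemma card_Me {n : ℕ} (S : Finset (Fin n)) : S.card * (n - 1) ≤ 2 * (Me S).card := by
  set s : Finset (Σ _ : Fin n, Fin n) := S.sigma fun v => Finset.univ.erase v with hs
  have hcard : s.card = S.card * (n - 1) := by
    rw [hs, Finset.card_sigma]; simp
  set f : (Σ _ : Fin n, Fin n) → Sym2 (Fin n) := fun p => s(p.1, p.2) with hf
  have h1 : s.card ≤ 2 * (s.image f).card := by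
    apply Finset.card_le_mul_card_image
    intro e he
    rw [Finset.mem_image] at he
    obtain ⟨p, hp, rfl⟩ := he
    have : s.filter (fun q => f q = f p) ⊆ {⟨p.1, p.2⟩, ⟨p.2, p.1⟩} := by
      intro q hq
      rw [Finset.mem_filter] at hq
      have h2 := hq.2
      simp only [hf, Sym2.eq_iff] at h2
      rcases q with ⟨q1, q2⟩
      rcases h2 with ⟨h3, h4⟩ | ⟨h3, h4⟩ <;> simp only at h3 h4 <;> subst h3 <;> subst h4 <;> simp
    exact (Finset.card_le_card this).trans Finset.card_le_two
  have h2 : s.image f ⊆ (Me S).image Subtype.val := by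
    intro e he
    rw [Finset.mem_image] at he
    obtain ⟨p, hp, rfl⟩ := he
    rw [hs, Finset.mem_sigma] at hp
    have hne : p.2 ≠ p.1 := Finset.ne_of_mem_erase hp.2
    have hd : ¬ (f p).IsDiag := by
      simp only [hf, Sym2.mk_isDiag_iff]
      exact fun h => hne h.symm
    rw [Finset.mem_image]
    refine ⟨⟨f p, hd⟩, ?_, rfl⟩
    simp only [Me, Finset.mem_filter, Finset.mem_univ, true_and]
    exact ⟨p.1, hp.1, by simp [hf]⟩
  have h3 := (Finset.card_le_card h2).trans Finset.card_image_le
  omega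

lemma card_fix {n : ℕ} (σ : Equiv.Perm (Fin n)) :
    ((Me σ.support).filter fun e => edgePerm σ e = e).card ≤ σ.support.card := by
  rw [← Finset.card_image_of_injective _ (Subtype.val_injective (p := fun e : Sym2 (Fin n) => ¬ e.IsDiag))]
  refine (Finset.card_le_card (t := σ.support.image fun v => s(v, σ v)) ?_).trans
    Finset.card_image_le
  intro e he
  rw [Finset.mem_image] at he
  obtain ⟨e', he', rfl⟩ := he
  rw [Finset.mem_filter] at he'
  obtain ⟨h1, h2⟩ := he'
  simp only [Me, Finset.mem_filter, Finset.mem_univ, true_and] at h1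
  obtain ⟨v, hv, hve⟩ := h1
  have h3 : Sym2.map σ e'.1 = e'.1 := congrArg Subtype.val h2
  rw [Finset.mem_image]
  refine ⟨v, hv, ?_⟩
  obtain ⟨u, hu⟩ := hve
  rw [hu] at h3 ⊢
  have h4 : σ v ∈ s(v, u) := by
    rw [← h3]; exact Sym2.mem_map.2 ⟨v, by simp, rfl⟩
  rcases Sym2.mem_iff.1 h4 with h5 | h5
  · exact absurd h5 (Equiv.Perm.mem_support.1 hv)
  · rw [h5]

lemma card_perm {n : ℕ} (S : Finset (Fin n)) :
    (Finset.univ.filter fun σ : Equiv.Perm (Fin n) => σ.support = S).card ≤ n ^ S.card := by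
  have : n ^ S.card = Fintype.card (S → Fin n) := by simp
  rw [this, ← Finset.card_univ]
  refine Finset.card_le_card_of_injOn (fun σ v => σ v.1) (fun _ _ => by simp) ?_
  intro σ hσ τ hτ h
  simp only [Finset.coe_filter, Finset.mem_univ, true_and, Set.mem_setOf_eq] at hσ hτ
  ext1 v
  by_cases hv : v ∈ S
  · exact congrFun h ⟨v, hv⟩
  · have h1 : v ∉ σ.support := by rwa [hσ]
    have h2 : v ∉ τ.support := by rwa [hτ]
    rw [Equiv.Perm.notMem_support] at h1 h2
    rw [h1, h2]

lemma markov_EE {Ω : Type*} [MeasurableSpace Ω] (μ : Measure Ω) (F : Ω → ℝ) (hF : Measurable F)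
    (c N : ℝ) (h : ∫⁻ ω, EE (F ω) ∂μ ≤ EE N) : μ {ω | c ≤ F ω} ≤ EE (N - c) := by
  have h1 := mul_meas_ge_le_lintegral (μ := μ) (measurable_EE.comp hF) (EE c)
  have h2 : {ω | c ≤ F ω} ⊆ {ω | EE c ≤ (EE ∘ F) ω} := fun ω hω => EE_mono hω
  have h3 : EE c * μ {ω | c ≤ F ω} ≤ EE N :=
    (mul_le_mul_right (measure_mono h2) _).trans (h1.trans h)
  have h4 : EE N = EE c * EE (N - c) := by rw [← EE_add]; congr 1; ring
  rw [h4] at h3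
  exact (ENNReal.mul_le_mul_iff_right (EE_ne_zero c) (EE_ne_top c)).1 h3

lemma measurable_SM {n d : ℕ} (a b : ℝ) (M : Finset (Edge n)) (S : Finset (Fin n))
    (σ : Equiv.Perm (Fin n)) : Measurable (SM (d := d) a b M S σ) := by
  unfold SM; fun_prop

lemma low_bound {n d : ℕ} {t a ρ b r : ℝ} (P : Par t a ρ) (Q : Par t b r)
    (S : Finset (Fin n)) (X : ℝ) (hX : X = (Me S).card * (a * ρ) + S.card * (d * (b * r))) :
    sample n d ρ r {ω | SM a b (Me S) S 1 ω ≤ (1 - t) * X} ≤ EE (-(t ^ 2 / 4) * X) := by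
  have hsub : {ω : Om n d | SM a b (Me S) S 1 ω ≤ (1 - t) * X} ⊆
      {ω | -(t / 2) * ((1 - t) * X) ≤ -(t / 2) * SM a b (Me S) S 1 ω} := by
    intro ω hω
    have := P.ht
    simp only [Set.mem_setOf_eq] at hω ⊢
    nlinarith
  refine (measure_mono hsub).trans ?_
  have := markov_EE (sample n d ρ r) (fun ω => -(t / 2) * SM a b (Me S) S 1 ω)
    ((measurable_SM a b _ _ _).const_mul _) (-(t / 2) * ((1 - t) * X)) (-(t / 2) * (1 - t / 2) * X) ?_
  · refine this.trans (EE_mono (le_of_eq ?_))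
    ring
  · have e : ∀ ω : Om n d, EE (-(t / 2) * SM a b (Me S) S 1 ω) =
        EE (∑ e ∈ Me S, -(t / 2) * (a * ((ω.1 e).1 * (ω.1 e).2))) *
        EE (∑ v ∈ S, ∑ i : Fin d, -(t / 2) * (b * ((ω.2 v).1 i * (ω.2 v).2 i))) := by
      intro ω
      rw [← EE_add]
      unfold SM
      simp_rw [mul_add, Finset.mul_sum, edgePerm_one]
      rfl
    simp_rw [e]
    unfold sample
    rw [lintegral_prod_mul
      (f := fun w : Edge n → ℝ × ℝ => EE (∑ e ∈ Me S, -(t / 2) * (a * ((w e).1 * (w e).2))))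
      (g := fun w : Fin n → (Fin d → ℝ) × (Fin d → ℝ) =>
        EE (∑ v ∈ S, ∑ i : Fin d, -(t / 2) * (b * ((w v).1 i * (w v).2 i))))
      (by fun_prop) (by fun_prop)]
    refine (mul_le_mul' (edges_low P (Me S)) (feats_low Q S)).trans ?_
    rw [← EE_add]
    refine EE_mono (le_of_eq ?_)
    rw [hX]
    simp only [Finset.sum_const, Finset.card_univ, Fintype.card_fin, nsmul_eq_mul]
    ring

lemma high_bound {n d : ℕ} {t a ρ b r : ℝ} (P : Par t a ρ) (Q : Par t b r)
    (σ : Equiv.Perm (Fin n)) (X : ℝ)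
    (hX : X = (Me σ.support).card * (a * ρ) + σ.support.card * (d * (b * r))) :
    sample n d ρ r {ω | (1 - t) * X ≤ SM a b (Me σ.support) σ.support σ ω} ≤
      EE (-(1 / 2 - 2 * t) * X + σ.support.card) := by
  have := markov_EE (sample n d ρ r) (fun ω => SM a b (Me σ.support) σ.support σ ω)
    (measurable_SM a b _ _ _) ((1 - t) * X) ((1 / 2 + t) * X + σ.support.card) ?_
  · refine this.trans (EE_mono (le_of_eq ?_))
    ring
  · unfold SM
    simp_rw [EE_add (∑ e ∈ _, _)]
    unfold sample
    rw [lintegral_prod_mul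
      (f := fun w : Edge n → ℝ × ℝ =>
        EE (∑ e ∈ Me σ.support, a * ((w e).1 * (w (edgePerm σ e)).2)))
      (g := fun w : Fin n → (Fin d → ℝ) × (Fin d → ℝ) =>
        EE (∑ v ∈ σ.support, ∑ i : Fin d, b * ((w v).1 i * (w (σ v)).2 i)))
      (by fun_prop) (by fun_prop)]
    refine (mul_le_mul' (edges_mgf P (edgePerm σ) _ (edgePerm_mem σ))
      (feat_mgf Q σ σ.support (fun e => Equiv.Perm.apply_mem_support))).trans ?_
    rw [← EE_add]
    refine EE_mono ?_
    have h0 : σ.support.filter (fun e => σ e = e) = ∅ := by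
      rw [Finset.filter_eq_empty_iff]
      intro v hv
      exact Equiv.Perm.mem_support.1 hv
    rw [h0, hX]
    have h1 : (((Me σ.support).filter fun e => edgePerm σ e = e).card : ℝ) ≤ σ.support.card := by
      exact_mod_cast card_fix σ
    simp only [Finset.sum_const, Finset.card_univ, Fintype.card_fin, nsmul_eq_mul,
      Finset.card_empty, Nat.cast_zero, mul_zero, add_zero]
    linarith

lemma bad_bound {n d : ℕ} {t a ρ b r α : ℝ} (P : Par t a ρ) (Q : Par t b r)
    (hn : 1 ≤ n) (hlog : 2 / t ≤ Real.log n)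
    (hY : (1 + t) * Real.log n ≤
      (1 / 2 - 2 * t) * (((n : ℝ) - 1) / 2 * (a * ρ) + d * (b * r))) :
    sample n d ρ r {ω | ∃ σ : Equiv.Perm (Fin n), α * n ≤ σ.support.card ∧
      SM a b Finset.univ Finset.univ 1 ω ≤ SM a b Finset.univ Finset.univ σ ω} ≤
      2 * EE (n - t ^ 2 / 4 * (α * n * Real.log n)) := by
  set L := Real.log n with hL
  set Y := ((n : ℝ) - 1) / 2 * (a * ρ) + d * (b * r) with hYd
  have ht := P.ht
  have ht1 := P.ht1
  have hL0 : 0 < L := lt_of_lt_of_le (by positivity) hlog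
  obtain ⟨-, -, -, -, h5, -, -⟩ := par_sq P
  obtain ⟨-, -, -, -, h5', -, -⟩ := par_sq Q
  have hn1 : (1 : ℝ) ≤ n := by exact_mod_cast hn
  have hY0 : 0 ≤ Y := by
    rw [hYd]
    have : 0 ≤ (n : ℝ) - 1 := by linarith
    positivity
  have hYL : L ≤ Y := by nlinarith
  have hlogt : 2 ≤ t * L := by rw [div_le_iff₀ ht] at hlog; linarith
  set X : Finset (Fin n) → ℝ := fun S =>
    (Me S).card * (a * ρ) + S.card * (d * (b * r)) with hX
  have hXY : ∀ S, S.card * Y ≤ X S := by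
    intro S
    have h1 : (S.card : ℝ) * ((n : ℝ) - 1) ≤ 2 * (Me S).card := by
      have := card_Me S
      have h2 : ((n - 1 : ℕ) : ℝ) = (n : ℝ) - 1 := by push_cast [Nat.cast_sub hn]; ring
      rw [← h2]
      exact_mod_cast this
    simp only [hX, hYd]
    nlinarith
  set T : Finset (Finset (Fin n)) := Finset.univ.filter fun S => α * n ≤ S.card with hT
  set B := EE (- (t ^ 2 / 4 * (α * n * L))) with hB
  have hlow : ∀ S ∈ T, sample n d ρ r {ω | SM a b (Me S) S 1 ω ≤ (1 - t) * X S} ≤ B := by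
    intro S hS
    rw [hT, Finset.mem_filter] at hS
    refine (low_bound P Q S (X S) rfl).trans (EE_mono ?_)
    have h1 : α * n * L ≤ X S := by
      calc α * n * L ≤ S.card * L := by gcongr; exact hS.2
        _ ≤ S.card * Y := by gcongr
        _ ≤ _ := hXY S
    have : 0 ≤ t ^ 2 / 4 := by positivity
    nlinarith
  have hhigh : ∀ S ∈ T, ∑ σ ∈ Finset.univ.filter (fun σ : Equiv.Perm (Fin n) => σ.support = S),
      sample n d ρ r {ω | (1 - t) * X S ≤ SM a b (Me S) S σ ω} ≤ B := by
    intro S hS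
    rw [hT, Finset.mem_filter] at hS
    have h1 : ∀ σ ∈ Finset.univ.filter (fun σ : Equiv.Perm (Fin n) => σ.support = S),
        sample n d ρ r {ω | (1 - t) * X S ≤ SM a b (Me S) S σ ω} ≤
        EE (-(1 / 2 - 2 * t) * X S + S.card) := by
      intro σ hσ
      have := (Finset.mem_filter.1 hσ).2
      subst this
      exact high_bound P Q σ _ rfl
    refine (Finset.sum_le_card_nsmul _ _ _ h1).trans ?_
    rw [nsmul_eq_mul]
    have h2 : (((Finset.univ.filter (fun σ : Equiv.Perm (Fin n) => σ.support = S)).card : ℕ) : ℝ≥0∞)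
        ≤ EE (L * S.card) := by
      have h3 : Real.exp (L * S.card) = ((n ^ S.card : ℕ) : ℝ) := by
        rw [mul_comm, Real.exp_nat_mul, hL, Real.exp_log (by linarith)]
        push_cast; rfl
      unfold EE
      rw [h3, ENNReal.ofReal_natCast]
      exact_mod_cast card_perm S
    refine (mul_le_mul' h2 le_rfl).trans ?_
    rw [← EE_add]
    refine EE_mono ?_
    have h4 : (1 / 2 - 2 * t) * (S.card * Y) ≤ (1 / 2 - 2 * t) * X S :=
      mul_le_mul_of_nonneg_left (hXY S) (by linarith)
    have h5 : (S.card : ℝ) * ((1 + t) * L) ≤ S.card * ((1 / 2 - 2 * t) * Y) := by gcongr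
    have h6 : (S.card : ℝ) * 2 ≤ S.card * (t * L) := by gcongr
    have h7 : α * n * L ≤ S.card * L := by gcongr; exact hS.2
    have h8 : t ^ 2 / 4 * (α * n * L) ≤ t ^ 2 / 4 * (S.card * L) := by gcongr
    have h9 : t ^ 2 / 4 * (S.card * L) ≤ t / 2 * (S.card * L) :=
      mul_le_mul_of_nonneg_right (by nlinarith) (by positivity)
    nlinarith
  have hsub : {ω : Om n d | ∃ σ : Equiv.Perm (Fin n), α * n ≤ σ.support.card ∧
      SM a b Finset.univ Finset.univ 1 ω ≤ SM a b Finset.univ Finset.univ σ ω} ⊆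
      ⋃ S ∈ T, ({ω | SM a b (Me S) S 1 ω ≤ (1 - t) * X S} ∪
        ⋃ σ ∈ Finset.univ.filter (fun σ : Equiv.Perm (Fin n) => σ.support = S),
          {ω | (1 - t) * X S ≤ SM a b (Me S) S σ ω}) := by
    rintro ω ⟨σ, h1, h2⟩
    have h3 := score_restrict a b σ ω h2
    refine Set.mem_biUnion (x := σ.support) (by simpa [hT] using h1) ?_
    rcases le_total (SM a b (Me σ.support) σ.support 1 ω) ((1 - t) * X σ.support) with h4 | h4
    · exact Or.inl h4
    · refine Or.inr (Set.mem_biUnion (x := σ) (by simp) ?_)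
      exact h4.trans h3
  refine (measure_mono hsub).trans ((measure_biUnion_finset_le _ _).trans ?_)
  calc _ ≤ ∑ S ∈ T, (B + B) := by
        refine Finset.sum_le_sum fun S hS => (measure_union_le _ _).trans ?_
        exact add_le_add (hlow S hS) ((measure_biUnion_finset_le _ _).trans (hhigh S hS))
    _ = T.card * (2 * B) := by rw [Finset.sum_const, nsmul_eq_mul, two_mul]
    _ ≤ EE n * (2 * B) := by
        gcongr
        have h1 : T.card ≤ 2 ^ n := by
          refine (Finset.card_le_univ _).trans ?_
          simp
        have h2 : ((2 : ℝ) ^ n) ≤ Real.exp n := by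
          have : Real.exp n = Real.exp 1 ^ n := by rw [← Real.exp_nat_mul, mul_one]
          rw [this]
          gcongr
          linarith [Real.add_one_le_exp (1 : ℝ)]
        unfold EE
        rw [← ENNReal.ofReal_natCast]
        apply ENNReal.ofReal_le_ofReal
        refine le_trans ?_ h2
        exact_mod_cast h1
    _ = _ := by
        rw [sub_eq_add_neg, EE_add]; ring

/-- the score used by the estimator -/
noncomputable def TT {n d : ℕ} (a b : ℝ) (π : Equiv.Perm (Fin n)) (o : Obs n d) : ℝ :=
  ∑ e : Edge n, a * (o.1 e * o.2.1 (edgeMap π e)) +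
    ∑ v : Fin n, ∑ i : Fin d, b * (o.2.2.1 v i * o.2.2.2 (π v) i)

lemma measurable_TT {n d : ℕ} (a b : ℝ) (π : Equiv.Perm (Fin n)) :
    Measurable (TT (d := d) a b π) := by
  unfold TT; fun_prop

lemma exists_est {n d : ℕ} (a b : ℝ) : ∃ est : Obs n d → Equiv.Perm (Fin n), Measurable est ∧
    ∀ o π, TT a b π o ≤ TT a b (est o) o := by
  classical
  obtain ⟨f, hf⟩ := exists_surjective_nat (Equiv.Perm (Fin n))
  have hex : ∀ o : Obs n d, ∃ k, ∀ π, TT a b π o ≤ TT a b (f k) o := by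
    intro o
    obtain ⟨π0, h0⟩ := Finite.exists_max (fun π => TT a b π o)
    obtain ⟨k, rfl⟩ := hf π0
    exact ⟨k, h0⟩
  refine ⟨fun o => f (Nat.find (hex o)), ?_, fun o => Nat.find_spec (hex o)⟩
  refine (measurable_from_top (f := f)).comp (measurable_find hex fun k => ?_)
  rw [show {o : Obs n d | ∀ π, TT a b π o ≤ TT a b (f k) o} =
    ⋂ π, {o | TT a b π o ≤ TT a b (f k) o} by ext; simp]
  exact MeasurableSet.iInter fun π => measurableSet_le (measurable_TT a b π) (measurable_TT a b _)

lemma TT_obsOf {n d : ℕ} (a b : ℝ) (πs π : Equiv.Perm (Fin n)) (ω : Om n d) :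
    TT a b π (obsOf πs ω) = SM a b Finset.univ Finset.univ (πs⁻¹ * π) ω := by
  have : ∀ e : Edge n, edgeMap πs⁻¹ (edgeMap π e) = edgePerm (πs⁻¹ * π) e := by
    intro e
    apply Subtype.ext
    change Sym2.map _ (Sym2.map _ _) = Sym2.map _ _
    rw [Sym2.map_map]; rfl
  unfold TT SM obsOf
  simp only [this]
  rfl

lemma measurable_obsOf {n d : ℕ} (πs : Equiv.Perm (Fin n)) :
    Measurable (obsOf (d := d) πs) := by
  unfold obsOf; fun_prop

lemma meas_bad {n d : ℕ} {a b ρ r δ : ℝ} (hn : 1 ≤ n) (est : Obs n d → Equiv.Perm (Fin n))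
    (hm : Measurable est) (he : ∀ o π, TT a b π o ≤ TT a b (est o) o)
    (πs : Equiv.Perm (Fin n)) (B : ℝ≥0∞)
    (hB : sample n d ρ r {ω | ∃ σ : Equiv.Perm (Fin n), (1 - δ) * n ≤ σ.support.card ∧
      SM a b Finset.univ Finset.univ 1 ω ≤ SM a b Finset.univ Finset.univ σ ω} ≤ B) 
    (hr : IsProbabilityMeasure (sample n d ρ r)) :
    1 - B ≤ obsLaw n d ρ r πs {o | δ ≤ overlap (est o) πs} ∧
      obsLaw n d ρ r πs {o | δ ≤ overlap (est o) πs} ≤ 1 := by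
  have hP : IsProbabilityMeasure (obsLaw n d ρ r πs) :=
    Measure.isProbabilityMeasure_map (measurable_obsOf πs).aemeasurable
  refine ⟨?_, prob_le_one⟩
  have hms : MeasurableSet {o : Obs n d | δ ≤ overlap (est o) πs} :=
    hm (t := {π | δ ≤ overlap π πs}) trivial
  rw [tsub_le_iff_right, ← prob_add_prob_compl (μ := obsLaw n d ρ r πs) hms]
  gcongr
  refine le_trans ?_ hB
  unfold obsLaw
  rw [Measure.map_apply (measurable_obsOf πs) hms.compl]
  refine measure_mono ?_
  intro ω hω
  have hω' : overlap (est (obsOf πs ω)) πs < δ := not_le.1 hω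
  set π := est (obsOf πs ω) with hπ
  refine ⟨πs⁻¹ * π, ?_, ?_⟩
  · unfold overlap at hω'
    have hn0 : (0 : ℝ) < n := by exact_mod_cast hn
    rw [div_lt_iff₀ hn0] at hω'
    have h1 : (πs⁻¹ * π).support = Finset.univ.filter fun v => ¬ (π v = πs v) := by
      ext v
      simp [Equiv.Perm.mem_support, Equiv.symm_apply_eq]
    have h2 := Finset.card_filter_add_card_filter_not (s := (Finset.univ : Finset (Fin n)))
      (fun v => π v = πs v)
    rw [← h1, Finset.card_univ, Fintype.card_fin] at h2
    have h3 : ((Finset.univ.filter fun v => π v = πs v).card : ℝ) +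
      ((πs⁻¹ * π).support.card : ℝ) = n := by exact_mod_cast h2
    linarith
  · have := he (obsOf πs ω) πs
    rw [TT_obsOf, TT_obsOf, inv_mul_cancel] at this
    exact this

lemma log_up {x c : ℝ} (hx : 0 < x) (hxc : x ≤ c) (hc : c < 1) :
    (1 - c ^ 2) * Real.log (1 / (1 - x ^ 2)) ≤ x ^ 2 := by
  have h1 : 0 < 1 - c ^ 2 := by nlinarith
  have h2 : 1 - c ^ 2 ≤ 1 - x ^ 2 := by nlinarith
  have h3 : 0 < 1 - x ^ 2 := by linarith
  have h4 := Real.log_le_sub_one_of_pos (x := 1 / (1 - x ^ 2)) (by positivity)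
  have h5 : 1 / (1 - x ^ 2) - 1 = x ^ 2 / (1 - x ^ 2) := by field_simp; ring
  rw [h5] at h4
  calc _ ≤ (1 - c ^ 2) * (x ^ 2 / (1 - x ^ 2)) := by gcongr
    _ ≤ (1 - x ^ 2) * (x ^ 2 / (1 - x ^ 2)) := by gcongr
    _ = x ^ 2 := by field_simp

lemma k6_aux {e : ℝ} (he : 0 < e) (he1 : e ≤ 1) :
    4 + e / 2 ≤ (1 - e / 100) * (1 - e / 100) * (4 + e) := by
  have h1 : e * e ≤ e * 1 := by gcongr
  have h2 : 0 ≤ e * e * e := by positivity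
  have h3 : 0 ≤ e * e := by positivity
  ring_nf at *
  linarith

lemma hY_of {n d ρ r e t c : ℝ} (he : 0 < e) (he1 : e ≤ 1) (ht : t = e / 100) (hc : c = t / 100)
    (hρ : 0 < ρ) (hr : 0 < r) (hn : 100 / e ≤ n) (hd0 : 0 ≤ d) (hL : 0 ≤ Real.log n)
    (h1 : 3 * Real.log n ≤ (n - 1) / 2 * c ^ 2) (h2 : 3 * Real.log n ≤ d * c ^ 2)
    (hthr : (4 + e) * Real.log n ≤
      n * Real.log (1 / (1 - ρ ^ 2)) + 2 * d * Real.log (1 / (1 - r ^ 2))) :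
    (1 + t) * Real.log n ≤
      (1 / 2 - 2 * t) * ((n - 1) / 2 * (min ρ c * ρ) + d * (min r c * r)) := by
  set L := Real.log n with hLd
  have hc0 : 0 < c := by rw [hc, ht]; positivity
  have hc1 : c < 1 := by rw [hc, ht]; linarith
  have hne : 100 ≤ n * e := by rw [div_le_iff₀ he] at hn; exact hn
  have hn1 : 100 ≤ n := by nlinarith
  have hn2 : 0 ≤ (n - 1) / 2 := by linarith
  have p1 : 0 ≤ min ρ c * ρ := by positivity
  have p2 : 0 ≤ min r c * r := by positivity
  suffices h : (2 + e / 4) * L ≤ (n - 1) / 2 * (min ρ c * ρ) + d * (min r c * r) by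
    have h3 : (1 / 2 - 2 * t) * ((2 + e / 4) * L) ≤ (1 / 2 - 2 * t) *
        ((n - 1) / 2 * (min ρ c * ρ) + d * (min r c * r)) :=
      mul_le_mul_of_nonneg_left h (by rw [ht]; linarith)
    refine le_trans ?_ h3
    rw [← mul_assoc]
    refine mul_le_mul_of_nonneg_right ?_ hL
    rw [ht]
    nlinarith
  rcases lt_or_ge c ρ with hcρ | hcρ
  · have q : c ^ 2 ≤ min ρ c * ρ := by rw [min_eq_right hcρ.le]; nlinarith
    have q1 : (n - 1) / 2 * c ^ 2 ≤ (n - 1) / 2 * (min ρ c * ρ) := by gcongr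
    have q2 : 0 ≤ d * (min r c * r) := by positivity
    nlinarith
  rcases lt_or_ge c r with hcr | hcr
  · have q : c ^ 2 ≤ min r c * r := by rw [min_eq_right hcr.le]; nlinarith
    have q1 : d * c ^ 2 ≤ d * (min r c * r) := by gcongr
    have q2 : 0 ≤ (n - 1) / 2 * (min ρ c * ρ) := by positivity
    nlinarith
  rw [min_eq_left hcρ, min_eq_left hcr]
  have l1 := log_up hρ hcρ hc1
  have l2 := log_up hr hcr hc1
  have k : 0 < 1 - c ^ 2 := by nlinarith
  have k1 : (1 - c ^ 2) * ((4 + e) * L) ≤ n * ρ ^ 2 + 2 * d * r ^ 2 := by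
    calc _ ≤ (1 - c ^ 2) * (n * Real.log (1 / (1 - ρ ^ 2)) + 2 * d * Real.log (1 / (1 - r ^ 2))) := by
          gcongr
      _ = n * ((1 - c ^ 2) * Real.log (1 / (1 - ρ ^ 2))) +
          2 * d * ((1 - c ^ 2) * Real.log (1 / (1 - r ^ 2))) := by ring
      _ ≤ _ := by gcongr
  have k2 : n - 1 ≥ (1 - e / 100) * n := by nlinarith
  have k3 : (1 - e / 100) * n * ρ ^ 2 ≤ (n - 1) * ρ ^ 2 := by gcongr
  have k4 : (1 - e / 100) * (d * r ^ 2) ≤ 1 * (d * r ^ 2) := by gcongr; linarith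
  have k5 : (1 - e / 100) * ((1 - c ^ 2) * ((4 + e) * L)) ≤
      (1 - e / 100) * (n * ρ ^ 2 + 2 * d * r ^ 2) :=
    mul_le_mul_of_nonneg_left k1 (by linarith)
  have hce : c ^ 2 ≤ e / 100 := by
    have : c ≤ e / 100 := by rw [hc, ht]; linarith
    have h8 : c * c ≤ c * 1 := by gcongr
    rw [pow_two]; linarith
  have k6 : (4 + e / 2) ≤ (1 - e / 100) * (1 - c ^ 2) * (4 + e) := by
    have : (1 - e / 100) * (1 - e / 100) ≤ (1 - e / 100) * (1 - c ^ 2) :=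
      mul_le_mul_of_nonneg_left (by linarith) (by linarith)
    have h7 : (1 - e / 100) * (1 - e / 100) * (4 + e) ≤ (1 - e / 100) * (1 - c ^ 2) * (4 + e) := by
      gcongr
    refine le_trans ?_ h7
    exact k6_aux he he1
  have k7 : (4 + e / 2) * L ≤ (1 - e / 100) * (1 - c ^ 2) * (4 + e) * L := by gcongr
  clear_value L
  linarith

lemma tendsto_bound {t α : ℝ} (ht : 0 < t) (hα : 0 < α) :
    Tendsto (fun n : ℕ => 2 * EE ((n : ℝ) - t ^ 2 / 4 * (α * n * Real.log n))) atTop (nhds 0) := by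
  have h1 : Tendsto (fun n : ℕ => (n : ℝ) - t ^ 2 / 4 * (α * n * Real.log n)) atTop atBot := by
    have hlog : Tendsto (fun n : ℕ => Real.log n) atTop atTop :=
      Real.tendsto_log_atTop.comp tendsto_natCast_atTop_atTop
    have h2 : Tendsto (fun n : ℕ => -(n : ℝ)) atTop atBot :=
      tendsto_neg_atTop_atBot.comp tendsto_natCast_atTop_atTop
    refine tendsto_atBot_mono' _ ?_ h2
    filter_upwards [hlog.eventually_ge_atTop (2 / (t ^ 2 / 4 * α))] with n hn
    rw [div_le_iff₀ (by positivity)] at hn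
    have : (n : ℝ) * 2 ≤ n * (Real.log n * (t ^ 2 / 4 * α)) := by gcongr
    nlinarith
  have h2 : Tendsto (fun n : ℕ => EE ((n : ℝ) - t ^ 2 / 4 * (α * n * Real.log n))) atTop (nhds 0) := by
    have := ENNReal.tendsto_ofReal (Real.tendsto_exp_atBot.comp h1)
    simpa [EE] using this
  simpa using ENNReal.Tendsto.const_mul h2 (Or.inr (by norm_num : (2 : ℝ≥0∞) ≠ ⊤))

/-- Theorem: partial recovery, possibility. Under the featured
correlated Gaussian Wigner model, if `d = ω(log n)` and
`n log(1/(1-ρ²)) + 2 d log(1/(1-r²)) ≥ (4+ε) log n`, then there is an estimator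
`π̂(G1, G2)` such that for every constant `0 < δ < 1` and every `π* ∈ S_n`,
`P[overlap(π̂, π*) ≥ δ] = 1 - o(1)` as `n → ∞`. -/
theorem partial_recovery_possible
    (d : ℕ → ℕ) (ρ r : ℕ → ℝ) (ε : ℝ)
    (hρ : ∀ n, 0 < ρ n ∧ ρ n < 1) (hr : ∀ n, 0 < r n ∧ r n < 1)
    (hd : Tendsto (fun n => (d n : ℝ) / Real.log n) atTop atTop)
    (hε : 0 < ε)
    (hthr : ∀ n : ℕ, (4 + ε) * Real.log n ≤
      (n : ℝ) * Real.log (1 / (1 - ρ n ^ 2)) + 2 * (d n : ℝ) * Real.log (1 / (1 - r n ^ 2))) :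
    ∃ est : (n : ℕ) → Obs n (d n) → Equiv.Perm (Fin n),
      (∀ n, Measurable (est n)) ∧
      ∀ δ : ℝ, 0 < δ → δ < 1 →
        ∀ πs : (n : ℕ) → Equiv.Perm (Fin n),
          Tendsto
            (fun n => obsLaw n (d n) (ρ n) (r n) (πs n)
              {o : Obs n (d n) | δ ≤ overlap (est n o) (πs n)})
            atTop (nhds 1) := by
  obtain ⟨e, he, he1, heε⟩ : ∃ e : ℝ, 0 < e ∧ e ≤ 1 ∧ e ≤ ε :=
    ⟨min ε 1, by positivity, min_le_right _ _, min_le_left _ _⟩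
  obtain ⟨t, ht⟩ : ∃ t, t = e / 100 := ⟨_, rfl⟩
  obtain ⟨c, hc⟩ : ∃ c, c = t / 100 := ⟨_, rfl⟩
  have ht0 : 0 < t := by rw [ht]; positivity
  have hc0 : 0 < c := by rw [hc]; positivity
  choose est hm hest using fun n => exists_est (n := n) (d := d n) (min (ρ n) c) (min (r n) c)
  refine ⟨est, hm, fun δ hδ0 hδ1 πs => ?_⟩
  have hlog : Tendsto (fun n : ℕ => Real.log n) atTop atTop :=
    Real.tendsto_log_atTop.comp tendsto_natCast_atTop_atTop
  have hB := tendsto_bound ht0 (sub_pos.2 hδ1)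
  have hB1 := ENNReal.Tendsto.sub (tendsto_const_nhds (x := (1 : ℝ≥0∞))) hB
    (Or.inl ENNReal.one_ne_top)
  rw [tsub_zero] at hB1
  have hlo : ∀ᶠ n : ℕ in atTop, Real.log n ≤ c ^ 2 / 12 * n := by
    have := (Real.isLittleO_log_id_atTop.comp_tendsto
      (tendsto_natCast_atTop_atTop (R := ℝ))).def (c := c ^ 2 / 12) (by positivity)
    filter_upwards [this] with n hn
    simp only [Function.comp, id, Real.norm_eq_abs, Nat.abs_cast] at hn
    exact (le_abs_self _).trans hn
  have key : ∀ᶠ n : ℕ in atTop,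
      1 - 2 * EE ((n : ℝ) - t ^ 2 / 4 * ((1 - δ) * n * Real.log n)) ≤
        obsLaw n (d n) (ρ n) (r n) (πs n) {o : Obs n (d n) | δ ≤ overlap (est n o) (πs n)} ∧
      obsLaw n (d n) (ρ n) (r n) (πs n) {o : Obs n (d n) | δ ≤ overlap (est n o) (πs n)} ≤ 1 := by
    filter_upwards [hlo, hlog.eventually_ge_atTop (2 / t),
      hd.eventually_ge_atTop (3 / c ^ 2), eventually_ge_atTop 2,
      (tendsto_natCast_atTop_atTop (R := ℝ)).eventually_ge_atTop (100 / e)] with n h1 h2 h3 h4 h5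
    have hL0 : 0 < Real.log n := lt_of_lt_of_le (by positivity) h2
    have P : Par t (min (ρ n) c) (ρ n) :=
      ⟨ht0, by rw [ht]; linarith, lt_min (hρ n).1 hc0, min_le_left _ _,
        hc ▸ min_le_right _ _, (hρ n).2⟩
    have Q : Par t (min (r n) c) (r n) :=
      ⟨ht0, by rw [ht]; linarith, lt_min (hr n).1 hc0, min_le_left _ _,
        hc ▸ min_le_right _ _, (hr n).2⟩
    have h4' : (2 : ℝ) ≤ n := by exact_mod_cast h4
    refine meas_bad (by omega) (est n) (hm n) (hest n) (πs n) _
      (bad_bound P Q (by omega) h2 ?_) inferInstance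
    refine hY_of he he1 ht hc (hρ n).1 (hr n).1 h5 (by positivity) hL0.le ?_ ?_ ?_
    · have : c ^ 2 * 2 ≤ c ^ 2 * n := by gcongr
      nlinarith
    · rw [div_le_div_iff₀ (by positivity) hL0] at h3
      exact h3
    · refine le_trans ?_ (hthr n)
      gcongr
  exact tendsto_of_tendsto_of_tendsto_of_le_of_le' hB1 tendsto_const_nhds
    (key.mono fun n h => h.1) (key.mono fun n h => h.2)

end FCGW
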